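/- Let p ≥ 3 be prime, s ≥ 1, and m_1, …, m_s ∈ {0,…,p-1}. For any integer k, the modified Lah polynomial evaluated at k satisfies P_{m_1·p + ⋯ + m_s·p^s}(k) ≡ (k+1)^{m_1 + m_2 + ⋯ + m_s} (mod p). -/

import Mathlib

open Polynomial Finset

/-- The Lah number `L(n,k) = C(n-1,k-1)·n!/k!`, with `L(0,0) = 1` and `L(n,0) = 0` for `n > 0`. -/
def lah (n k : ℕ) : ℕ :=
  if k = 0 then (if n = 0 then 1 else 0)
  else (n - 1).choose (k - 1) * n.factorial / k.factorial

/-- `L_n`, the total number of partitions of an n-set into nonempty ordered lists. -/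
def lahTotal (n : ℕ) : ℕ := ∑ k ∈ Finset.range (n + 1), lah n k

/-- The modified Lah polynomial `P_n(x) = ∑_{k=0}^n C(n,k)·L_k·x^{n-k}`. -/
noncomputable def modLahPoly (n : ℕ) : Polynomial ℤ :=
  ∑ k ∈ Finset.range (n + 1), ((n.choose k * lahTotal k : ℤ)) • X ^ (n - k)

/-- The Lah numbers summed in reverse: the index `j` stands for `n - k` in `L(n,k)`. -/
lemma lahTotal_eq_sum_choose_mul_descFactorial (n : ℕ) :
    lahTotal n = ∑ j ∈ range (n + 1), (n - 1).choose j * n.descFactorial j := by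
  rw [lahTotal, ← sum_range_reflect]
  refine sum_congr rfl fun j hj => ?_
  have hjn : j ≤ n := Nat.lt_succ_iff.mp (mem_range.mp hj)
  rw [show n + 1 - 1 - j = n - j by omega]
  rcases hjn.eq_or_lt with rfl | hlt
  · rcases j with _ | j <;> simp [lah]
  · rw [lah, if_neg (by omega), Nat.descFactorial_eq_div hjn,
      Nat.mul_div_assoc _ (Nat.factorial_dvd_factorial (Nat.sub_le n j)),
      ← Nat.choose_symm (show j ≤ n - 1 by omega), show n - j - 1 = n - 1 - j by omega]

/-- Modulo a prime `p`, the number `L_n` is a function of the residue of `n`. -/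
lemma lahTotal_cast_zmod (p : ℕ) [Fact p.Prime] (n : ℕ) :
    (lahTotal n : ZMod p) = ∑ j ∈ range p, (descPochhammer (ZMod p) j).eval ((n : ZMod p) - 1) *
      (descPochhammer (ZMod p) j).eval (n : ZMod p) * (j.factorial : ZMod p)⁻¹ := by
  have hvanish (j : ℕ) (hj : p ≤ j) : (n.descFactorial j : ZMod p) = 0 := by
    rw [ZMod.natCast_eq_zero_iff]
    exact (Nat.dvd_factorial (Fact.out : p.Prime).pos hj).trans (Nat.factorial_dvd_descFactorial n j)
  have hleft : (lahTotal n : ZMod p) =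
      ∑ j ∈ range p, ((n - 1).choose j * n.descFactorial j : ZMod p) := by
    rw [lahTotal_eq_sum_choose_mul_descFactorial]
    push_cast
    rcases le_total (n + 1) p with h | h
    · refine sum_subset (range_mono h) fun j _ hj => ?_
      rw [Nat.descFactorial_of_lt (by simpa [Nat.lt_succ_iff] using hj)]
      simp
    · refine (sum_subset (range_mono h) fun j _ hj => ?_).symm
      rw [hvanish j (by simpa using hj), mul_zero]
  rw [hleft]
  refine sum_congr rfl fun j hj => ?_
  have hfac : (j.factorial : ZMod p) ≠ 0 := by
    rw [Ne, ZMod.natCast_eq_zero_iff, (Fact.out : p.Prime).dvd_factorial]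
    exact (mem_range.mp hj).not_ge
  rw [eq_mul_inv_iff_mul_eq₀ hfac, descPochhammer_eval_eq_descFactorial]
  rcases n with _ | n
  · rcases j with _ | j <;> simp
  · rw [show ((n + 1 : ℕ) : ZMod p) - 1 = n by push_cast; ring,
      descPochhammer_eval_eq_descFactorial, Nat.add_sub_cancel,
      Nat.descFactorial_eq_factorial_mul_choose n j]
    push_cast
    ring

lemma lahTotal_add_prime (p : ℕ) [Fact p.Prime] (n : ℕ) :
    (lahTotal (n + p) : ZMod p) = lahTotal n := by
  simp [lahTotal_cast_zmod]

/-- The umbral functional sending `X ^ n` to `L_n`. -/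
noncomputable def lahFunctional (R : Type*) [CommSemiring R] : R[X] →ₗ[R] R :=
  Polynomial.lsum fun n => (lahTotal n : R) • LinearMap.id

lemma lahFunctional_X_pow (R : Type*) [CommSemiring R] (n : ℕ) :
    lahFunctional R (X ^ n) = lahTotal n := by
  rw [X_pow_eq_monomial, lahFunctional, Polynomial.lsum_apply, sum_monomial_index] <;> simp

lemma modLahPoly_eval_cast (R : Type*) [CommRing R] (n : ℕ) (k : ℤ) :
    (((modLahPoly n).eval k : ℤ) : R) = lahFunctional R ((X + C (k : R)) ^ n) := by
  rw [modLahPoly, eval_finsetSum, add_pow, map_sum]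
  push_cast
  refine sum_congr rfl fun j _ => ?_
  rw [show (X : R[X]) ^ j * C (k : R) ^ (n - j) * (n.choose j : R[X]) =
      ((k : R) ^ (n - j) * (n.choose j : R)) • X ^ j by
    rw [smul_eq_C_mul]; simp; ring]
  rw [map_smul, lahFunctional_X_pow]
  simp
  ring

lemma lahFunctional_X_pow_prime_mul (p : ℕ) [Fact p.Prime] (q : (ZMod p)[X]) :
    lahFunctional (ZMod p) (X ^ p * q) = lahFunctional (ZMod p) q := by
  induction q using Polynomial.induction_on' with
  | add a b ha hb => rw [mul_add, map_add, map_add, ha, hb]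
  | monomial n a =>
    rw [← C_mul_X_pow_eq_monomial, mul_left_comm, ← pow_add, ← smul_eq_C_mul, ← smul_eq_C_mul,
      map_smul, map_smul, lahFunctional_X_pow, lahFunctional_X_pow, add_comm p n,
      lahTotal_add_prime]

lemma modLahPoly_eval_mul_prime (p : ℕ) [Fact p.Prime] (n : ℕ) (k : ℤ) :
    (((modLahPoly (p * n)).eval k : ℤ) : ZMod p) = ((k : ZMod p) + 1) ^ n := by
  rw [modLahPoly_eval_cast, pow_mul, add_pow_char, ← C_pow, ZMod.pow_card]
  induction n with
  | zero => simpa [lahTotal, lah] using lahFunctional_X_pow (ZMod p) 0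
  | succ n ih =>
    rw [pow_succ', add_mul, map_add, lahFunctional_X_pow_prime_mul, ← smul_eq_C_mul, map_smul, ih,
      smul_eq_mul]
    ring

theorem modLahPoly_eval (p : ℕ) (hp : p.Prime) (hp3 : 3 ≤ p) (s : ℕ) (hs : 1 ≤ s)
    (m : ℕ → ℕ) (hm : ∀ i, 1 ≤ i → i ≤ s → m i < p) (k : ℤ) :
    (modLahPoly (∑ i ∈ Finset.Icc 1 s, m i * p ^ i)).eval k ≡
      (k + 1) ^ (∑ i ∈ Finset.Icc 1 s, m i) [ZMOD p] := by
  have := Fact.mk hp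
  rw [← ZMod.intCast_eq_intCast_iff]
  have hsum : ∑ i ∈ Finset.Icc 1 s, m i * p ^ i =
      p * ∑ i ∈ Finset.Icc 1 s, m i * p ^ (i - 1) := by
    rw [mul_sum]
    refine sum_congr rfl fun i hi => ?_
    rw [← mul_pow_sub_one (by have := (Finset.mem_Icc.mp hi).1; omega) p]
    ring
  rw [hsum, modLahPoly_eval_mul_prime]
  push_cast
  rw [← prod_pow_eq_pow_sum, ← prod_pow_eq_pow_sum]
  refine prod_congr rfl fun i _ => ?_
  rw [mul_comm, pow_mul, ZMod.pow_card_pow]
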